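/- The Ricci curvature Ric_{λν} := R[Γ]^μ_{λμν} of the full connection of a generalised pp-wave with purely axial torsion vanishes identically if and only if f satisfies the Poisson-type equation ∂₁²f + ∂₂²f = k(x³)² everywhere on ℝ⁴. -/

import Mathlib

noncomputable section

open scoped BigOperators

/-- Points of spacetime: ℝ⁴ with coordinates x⁰, x¹, x², x³. -/
abbrev Spacetime := Fin 4 → ℝ

/-- Partial derivative ∂_μ of a scalar function. -/
def pd (μ : Fin 4) (h : Spacetime → ℝ) : Spacetime → ℝ :=
  fun x => fderiv ℝ h x (Pi.single μ 1)

/-- The pp-metric g_{μν}: nonzero components g₀₃ = g₃₀ = 1, g₁₁ = g₂₂ = −1, g₃₃ = f. -/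
def ppMetric (f : Spacetime → ℝ) (x : Spacetime) (μ ν : Fin 4) : ℝ :=
  if μ = 0 ∧ ν = 3 then 1 else if μ = 3 ∧ ν = 0 then 1
  else if μ = 1 ∧ ν = 1 then -1 else if μ = 2 ∧ ν = 2 then -1
  else if μ = 3 ∧ ν = 3 then f x else 0

/-- The pointwise inverse metric g^{μν}: g⁰⁰ = −f, g⁰³ = g³⁰ = 1, g¹¹ = g²² = −1. -/
def ppMetricInv (f : Spacetime → ℝ) (x : Spacetime) (μ ν : Fin 4) : ℝ :=
  if μ = 0 ∧ ν = 0 then -(f x) else if μ = 0 ∧ ν = 3 then 1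
  else if μ = 3 ∧ ν = 0 then 1
  else if μ = 1 ∧ ν = 1 then -1 else if μ = 2 ∧ ν = 2 then -1 else 0

/-- Christoffel symbols {Γ}^λ_{μν} = ½ g^{λκ}(∂_μ g_{κν} + ∂_ν g_{κμ} − ∂_κ g_{μν}). -/
def christoffel (f : Spacetime → ℝ) (x : Spacetime) (l μ ν : Fin 4) : ℝ :=
  (1/2) * ∑ κ, ppMetricInv f x l κ *
    (pd μ (fun y => ppMetric f y κ ν) x + pd ν (fun y => ppMetric f y κ μ) x
      - pd κ (fun y => ppMetric f y μ ν) x)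

/-- Totally antisymmetric symbol ε with ε₀₁₂₃ = 1. -/
def eps (a b c d : Fin 4) : ℝ :=
  ((((b:ℕ):ℝ) - ((a:ℕ):ℝ)) * (((c:ℕ):ℝ) - ((a:ℕ):ℝ)) * (((d:ℕ):ℝ) - ((a:ℕ):ℝ)) *
    (((c:ℕ):ℝ) - ((b:ℕ):ℝ)) * (((d:ℕ):ℝ) - ((b:ℕ):ℝ)) * (((d:ℕ):ℝ) - ((c:ℕ):ℝ))) / 12

/-- Purely axial torsion T_{κμν} = k(x³) ε_{0κμν}. -/
def torsion (k : ℝ → ℝ) (x : Spacetime) (κ μ ν : Fin 4) : ℝ :=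
  k (x 3) * eps 0 κ μ ν

/-- Contorsion K^κ_{μν} = ½ g^{κρ} T_{ρμν}. -/
def contorsion (f : Spacetime → ℝ) (k : ℝ → ℝ) (x : Spacetime) (κ μ ν : Fin 4) : ℝ :=
  (1/2) * ∑ ρ, ppMetricInv f x κ ρ * torsion k x ρ μ ν

/-- The full connection Γ^λ_{μν} = {Γ}^λ_{μν} + K^λ_{μν}. -/
def fullConn (f : Spacetime → ℝ) (k : ℝ → ℝ) (x : Spacetime) (κ μ ν : Fin 4) : ℝ :=
  christoffel f x κ μ ν + contorsion f k x κ μ ν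

/-- Curvature R[A]^κ_{λμν} of connection coefficients A^κ_{μν}. -/
def curv (A : Spacetime → Fin 4 → Fin 4 → Fin 4 → ℝ) (x : Spacetime)
    (κ l μ ν : Fin 4) : ℝ :=
  pd μ (fun y => A y κ ν l) x - pd ν (fun y => A y κ μ l) x
    + ∑ η, (A x κ μ η * A x η ν l - A x κ ν η * A x η μ l)

/-- The parallel null vector field l^μ = (1,0,0,0). -/
def lUp : Fin 4 → ℝ := fun μ => if μ = 0 then 1 else 0

/-- The lowered vector l_μ = g_{μν} l^ν = (0,0,0,1). -/
def lCov : Fin 4 → ℝ := fun μ => if μ = 3 then 1 else 0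

/-- Ricci curvature of the full connection: Ric_{λν} = R[Γ]^μ_{λμν}. -/
def RicFull (f : Spacetime → ℝ) (k : ℝ → ℝ) (x : Spacetime) (lam ν : Fin 4) : ℝ :=
  ∑ μ, curv (fullConn f k) x μ lam μ ν

theorem pd_const (μ : Fin 4) (c : ℝ) (x : Spacetime) : pd μ (fun _ => c) x = 0 := by
  simp [pd]

theorem pd_ppMetric (f : Spacetime → ℝ) (x : Spacetime) (a μ ν : Fin 4) :
    pd a (fun y => ppMetric f y μ ν) x = if μ = 3 ∧ ν = 3 then pd a f x else 0 := by
  fin_cases μ <;> fin_cases ν <;> simp [ppMetric, pd_const]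

theorem differentiable_pd {f : Spacetime → ℝ} (hf : ContDiff ℝ (⊤ : ℕ∞) f) (μ : Fin 4) :
    Differentiable ℝ (pd μ f) :=
  (((contDiff_infty.1 hf 2).fderiv_right (m := 1) (by norm_num)).clm_apply contDiff_const).differentiable
    (by simp)

/-- Partial derivatives of a smooth function commute. -/
theorem pd_comm {f : Spacetime → ℝ} (hf : ContDiff ℝ (⊤ : ℕ∞) f) (μ ν : Fin 4)
    (x : Spacetime) : pd μ (pd ν f) x = pd ν (pd μ f) x := by
  have hd : DifferentiableAt ℝ (fderiv ℝ f) x :=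
    ((contDiff_infty.1 hf 2).fderiv_right (m := 1) (by norm_num)).differentiable (by simp) x
  have key (a b : Fin 4) : pd a (pd b f) x
      = fderiv ℝ (fderiv ℝ f) x (Pi.single a 1) (Pi.single b 1) := by
    change fderiv ℝ (fun y => fderiv ℝ f y (Pi.single b 1)) x (Pi.single a 1) = _
    rw [fderiv_clm_apply hd (differentiableAt_const _)]
    simp
  rw [key, key]
  exact ((contDiff_infty.1 hf 2).contDiffAt.isSymmSndFDerivAt (by simp)).eq _ _

theorem pd_comp_coord {k : ℝ → ℝ} (hk : Differentiable ℝ k) {μ ν : Fin 4} (h : μ ≠ ν)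
    (x : Spacetime) : pd μ (fun y => k (y ν)) x = 0 := by
  have hp : HasFDerivAt (fun y : Spacetime => y ν)
      (ContinuousLinearMap.proj (R := ℝ) (φ := fun _ : Fin 4 => ℝ) ν) x :=
    (ContinuousLinearMap.proj (R := ℝ) (φ := fun _ : Fin 4 => ℝ) ν).hasFDerivAt
  have hc := (hk (x ν)).hasDerivAt.comp_hasFDerivAt x hp
  change fderiv ℝ (k ∘ fun y : Spacetime => y ν) x _ = 0
  rw [hc.fderiv]
  simp [h.symm]

/-- Components of the full connection of a generalised pp-wave with axial torsion. -/
def ppConn (f : Spacetime → ℝ) (k : ℝ → ℝ) (x : Spacetime) : Fin 4 → Fin 4 → Fin 4 → ℝ :=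
  ![![![0, 0, 0, 0],
      ![0, 0, 1 / 2 * k (x 3), 1 / 2 * pd 1 f x],
      ![0, -1 / 2 * k (x 3), 0, 1 / 2 * pd 2 f x],
      ![0, 1 / 2 * pd 1 f x, 1 / 2 * pd 2 f x, 1 / 2 * pd 3 f x]],
    ![![0, 0, 0, 0],
      ![0, 0, 0, 0],
      ![0, 0, 0, -1 / 2 * k (x 3)],
      ![0, 0, 1 / 2 * k (x 3), 1 / 2 * pd 1 f x]],
    ![![0, 0, 0, 0],
      ![0, 0, 0, 1 / 2 * k (x 3)],
      ![0, 0, 0, 0],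
      ![0, -1 / 2 * k (x 3), 0, 1 / 2 * pd 2 f x]],
    ![![0, 0, 0, 0], ![0, 0, 0, 0], ![0, 0, 0, 0], ![0, 0, 0, 0]]]

theorem fullConn_eq_ppConn {f : Spacetime → ℝ} (h0 : ∀ x, pd 0 f x = 0) (k : ℝ → ℝ)
    (x : Spacetime) : fullConn f k x = ppConn f k x := by
  funext a b c
  simp only [fullConn, christoffel, contorsion, torsion, pd_ppMetric, Fin.sum_univ_four]
  fin_cases a <;> fin_cases b <;> fin_cases c <;>
    simp [ppMetricInv, eps, ppConn, h0] <;> ring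

theorem pd_const_mul {g : Spacetime → ℝ} (hg : Differentiable ℝ g) (μ : Fin 4) (c : ℝ)
    (x : Spacetime) : pd μ (fun y => c * g y) x = c * pd μ g x := by
  simp [pd, fderiv_const_mul (hg x)]

/-- The only nonzero component of the Ricci curvature is `Ric₃₃ = ½ (∂₁²f + ∂₂²f - k²)`. -/
theorem RicFull_eq {f : Spacetime → ℝ} (hf : ContDiff ℝ (⊤ : ℕ∞) f)
    (h0 : ∀ x, pd 0 f x = 0) {k : ℝ → ℝ} (hk : Differentiable ℝ k)
    (x : Spacetime) (l ν : Fin 4) :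
    RicFull f k x l ν = if l = 3 ∧ ν = 3 then
      1 / 2 * (pd 1 (pd 1 f) x + pd 2 (pd 2 f) x - k (x 3) ^ 2) else 0 := by
  have h00 (j : Fin 4) : pd 0 (pd j f) x = 0 := by
    rw [pd_comm hf, show pd 0 f = fun _ => 0 from funext h0, pd_const]
  have hkd : Differentiable ℝ (fun y : Spacetime => k (y 3)) := by fun_prop
  have hf1 (μ j : Fin 4) (c : ℝ) := pd_const_mul (differentiable_pd hf j) μ c x
  have hk1 (μ : Fin 4) (c : ℝ) := pd_const_mul hkd μ c x
  have k0 : pd 0 (fun y => k (y 3)) x = 0 := pd_comp_coord hk (by decide) x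
  have k1 : pd 1 (fun y => k (y 3)) x = 0 := pd_comp_coord hk (by decide) x
  have k2 : pd 2 (fun y => k (y 3)) x = 0 := pd_comp_coord hk (by decide) x
  have hA : fullConn f k = ppConn f k := funext (fullConn_eq_ppConn h0 k)
  simp only [RicFull, curv, Fin.sum_univ_four, hA]
  fin_cases l <;> fin_cases ν <;>
    simp [ppConn, pd_const, hf1, hk1, h00, k0, k1, k2, -one_div]
  ring

/-- Ric = 0 iff the Poisson-type equation ∂₁²f + ∂₂²f = k(x³)² holds. -/
theorem full_ricci_zero_iff_poisson
    (f : Spacetime → ℝ) (hf : ContDiff ℝ (⊤ : ℕ∞) f) (h0 : ∀ x, pd 0 f x = 0)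
    (k : ℝ → ℝ) (hk : ContDiff ℝ (⊤ : ℕ∞) k) :
    (∀ (x : Spacetime) (lam ν : Fin 4), RicFull f k x lam ν = 0)
      ↔ (∀ x : Spacetime, pd 1 (pd 1 f) x + pd 2 (pd 2 f) x = (k (x 3))^2) := by
  simp only [RicFull_eq hf h0 (hk.differentiable (by simp))]
  refine ⟨fun h x => ?_, fun h x l ν => ?_⟩
  · have := h x 3 3
    simp only [and_self, if_true] at this
    linarith
  · rw [h x]
    simp
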